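/- Let $d \ge 3$ be an integer, $k \ge 1$ an integer, and $\widehat N \ge 1$ a real number with $2^{-k}\widehat N^d \ge 2$. Let $x \in \mathbb{Z}^d$ and let $A \subseteq B_x(2\widehat N)$ be a finite set of lattice points with $|A| \ge 2^{-k}\widehat N^d$. Then $\sum_{y \in A\setminus\{x\}} |x-y|^{2-d} \ge d^{-2d}\, 2^{-k}\, \widehat N^2$. -/

import Mathlib

open Classical

/-- Euclidean distance between two points of `ℤ^d`. -/
noncomputable def eDist (d : ℕ) (x y : Fin d → ℤ) : ℝ :=
  Real.sqrt (∑ i, ((x i - y i : ℤ) : ℝ) ^ 2)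

/-- `|x-y|^a` with the convention `0^a := 1` (used for negative exponents `a`). -/
noncomputable def invPow (d : ℕ) (a : ℝ) (x y : Fin d → ℤ) : ℝ :=
  if x = y then 1 else (eDist d x y) ^ a

/-- `y ∈ B_x(r)`, the sup-norm box of radius `r` centered at `x`. -/
def inBox (d : ℕ) (x : Fin d → ℤ) (r : ℝ) (y : Fin d → ℤ) : Prop :=
  ∀ i, |((y i - x i : ℤ) : ℝ)| ≤ r

lemma eDist_pos {d : ℕ} {x y : Fin d → ℤ} (h : x ≠ y) : 0 < eDist d x y := by
  obtain ⟨i, hi⟩ := Function.ne_iff.mp h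
  refine Real.sqrt_pos.mpr (Finset.sum_pos' (fun j _ => sq_nonneg _) ⟨i, Finset.mem_univ i, ?_⟩)
  have : ((x i - y i : ℤ) : ℝ) ≠ 0 := by exact_mod_cast sub_ne_zero.mpr hi
  positivity

lemma eDist_le_of_inBox {d : ℕ} {x y : Fin d → ℤ} {r : ℝ} (h : inBox d x r y) :
    eDist d x y ≤ Real.sqrt (d * r ^ 2) := by
  refine Real.sqrt_le_sqrt ?_
  calc ∑ i, ((x i - y i : ℤ) : ℝ) ^ 2 ≤ ∑ _i : Fin d, r ^ 2 := by
        refine Finset.sum_le_sum fun i _ => ?_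
        rw [← neg_sub (y i) (x i), Int.cast_neg, neg_sq]
        exact sq_le_sq' (abs_le.mp (h i)).1 (abs_le.mp (h i)).2
    _ = d * r ^ 2 := by simp

lemma rpow_le_invPow_of_inBox {d : ℕ} (hd : 2 ≤ d) {x y : Fin d → ℤ} {r : ℝ}
    (hxy : x ≠ y) (h : inBox d x r y) :
    Real.sqrt (d * r ^ 2) ^ (2 - d : ℝ) ≤ invPow d (2 - d) x y := by
  rw [invPow, if_neg hxy]
  have hd' : (2 : ℝ) ≤ d := by exact_mod_cast hd
  exact Real.rpow_le_rpow_of_nonpos (eDist_pos hxy) (eDist_le_of_inBox h) (by linarith)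

theorem stmt_3 (d k : ℕ) (hd : 3 ≤ d) (hk : 1 ≤ k)
    (Nh : ℝ) (hN1 : 1 ≤ Nh) (hN2 : (2 : ℝ) ≤ (2 : ℝ) ^ (-(k : ℝ)) * Nh ^ (d : ℝ))
    (x : Fin d → ℤ) (A : Finset (Fin d → ℤ))
    (hA : ∀ y ∈ A, inBox d x (2 * Nh) y)
    (hcard : (2 : ℝ) ^ (-(k : ℝ)) * Nh ^ (d : ℝ) ≤ (A.card : ℝ)) :
    (d : ℝ) ^ (-(2 * (d : ℝ))) * (2 : ℝ) ^ (-(k : ℝ)) * Nh ^ 2 ≤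
      ∑ y ∈ A.erase x, invPow d (2 - d) x y := by
  have hd' : (3 : ℝ) ≤ d := by exact_mod_cast hd
  have hN : 0 < Nh := by linarith
  have hd0 : (0 : ℝ) < d := by linarith
  set c : ℝ := (2 : ℝ) ^ (-(k : ℝ))
  have hc0 : 0 < c := by positivity
  have hr : Real.sqrt (d * (2 * Nh) ^ 2) ≤ (d : ℝ) ^ 2 * Nh := by
    refine Real.sqrt_le_iff.mpr ⟨by positivity, ?_⟩
    have h4 : (4 : ℝ) ≤ (d : ℝ) ^ 3 := by nlinarith [sq_nonneg ((d : ℝ) - 3)]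
    calc (d : ℝ) * (2 * Nh) ^ 2 = 4 * (d * Nh ^ 2) := by ring
      _ ≤ (d : ℝ) ^ 3 * (d * Nh ^ 2) := by gcongr
      _ = ((d : ℝ) ^ 2 * Nh) ^ 2 := by ring
  have hterm : ∀ y ∈ A.erase x, ((d : ℝ) ^ 2 * Nh) ^ (2 - d : ℝ) ≤ invPow d (2 - d) x y := by
    intro y hy
    obtain ⟨hyx, hyA⟩ := Finset.mem_erase.mp hy
    exact (Real.rpow_le_rpow_of_nonpos (by positivity) hr (by linarith)).trans
      (rpow_le_invPow_of_inBox (by omega) (Ne.symm hyx) (hA y hyA))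
  have hcount : c * Nh ^ (d : ℝ) / 2 ≤ ((A.erase x).card : ℝ) := by
    have h1 : (A.card : ℝ) ≤ (A.erase x).card + 1 := by
      exact_mod_cast Nat.sub_le_iff_le_add.mp Finset.pred_card_le_card_erase
    linarith
  have hpow : ((d : ℝ) ^ 2 * Nh) ^ (2 - d : ℝ) * Nh ^ (d : ℝ)
      = (d : ℝ) ^ 4 * ((d : ℝ) ^ (-(2 * (d : ℝ))) * Nh ^ 2) := by
    rw [Real.mul_rpow (by positivity) hN.le, mul_assoc, ← Real.rpow_add hN,
      ← Real.rpow_natCast_mul hd0.le, ← Real.rpow_natCast (d : ℝ) 4, ← mul_assoc,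
      ← Real.rpow_add hd0, ← Real.rpow_natCast Nh 2]
    congr 2 <;> push_cast <;> ring
  have hfour : (2 : ℝ) ≤ (d : ℝ) ^ 4 := by nlinarith [sq_nonneg ((d : ℝ) ^ 2 - 9)]
  calc (d : ℝ) ^ (-(2 * (d : ℝ))) * c * Nh ^ 2
      = 2 * ((d : ℝ) ^ (-(2 * (d : ℝ))) * Nh ^ 2) * (c / 2) := by ring
    _ ≤ (d : ℝ) ^ 4 * ((d : ℝ) ^ (-(2 * (d : ℝ))) * Nh ^ 2) * (c / 2) := by gcongr
    _ = c * Nh ^ (d : ℝ) / 2 * ((d : ℝ) ^ 2 * Nh) ^ (2 - d : ℝ) := by rw [← hpow]; ring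
    _ ≤ (A.erase x).card * ((d : ℝ) ^ 2 * Nh) ^ (2 - d : ℝ) := by gcongr
    _ ≤ ∑ y ∈ A.erase x, invPow d (2 - d) x y := by
        rw [← nsmul_eq_mul]
        exact Finset.card_nsmul_le_sum _ _ _ hterm
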